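/- Let G be a finite simple graph with a perfect matching, and let C_1, C_2, …, C_m be nice cycles of G such that every edge of G belongs to at most two of the edge sets E(C_1), …, E(C_m). Then the complete forcing number of G satisfies cf(G) ≥ m. (Applied to a normal hexagonal system with n hexagons, taking the n hexagonal faces together with the boundary of the exterior face, this yields cf ≥ n + 1.) -/

import Mathlib

open SimpleGraph

/-- A perfect matching of `G`, given as a set of edges. -/
def IsPerfMatching {V : Type*} (G : SimpleGraph V) (M : Set (Sym2 V)) : Prop :=
  M ⊆ G.edgeSet ∧ ∀ v : V, ∃! e, e ∈ M ∧ v ∈ e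

/-- `S` is a forcing set of the perfect matching `M`. -/
def IsForcingSet {V : Type*} (G : SimpleGraph V) (M S : Set (Sym2 V)) : Prop :=
  S ⊆ M ∧ ∀ M', IsPerfMatching G M' → S ⊆ M' → M' = M

/-- A complete forcing set of `G`. -/
def IsCompleteForcing {V : Type*} (G : SimpleGraph V) (S : Set (Sym2 V)) : Prop :=
  S ⊆ G.edgeSet ∧ ∀ M, IsPerfMatching G M → IsForcingSet G M (M ∩ S)

/-- The complete forcing number of `G`. -/
noncomputable def cfn {V : Type*} (G : SimpleGraph V) : ℕ :=
  sInf {n | ∃ S : Set (Sym2 V), IsCompleteForcing G S ∧ S.ncard = n}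

/-- A nice cycle of `G`. -/
def IsNiceCycle {V : Type*} (G : SimpleGraph V) {u : V} (c : G.Walk u u) : Prop :=
  c.IsCycle ∧ ∃ M : Set (Sym2 V), M ⊆ G.edgeSet ∧
    (∀ e ∈ M, ∀ x, x ∈ e → x ∉ c.support) ∧
    ∀ x : V, x ∉ c.support → ∃! e, e ∈ M ∧ x ∈ e

theorem even_ncard_of_existsUnique_edge {V : Type*} [Finite V] (G : SimpleGraph V)
    (A : Set V) (M : Set (Sym2 V)) (hMG : M ⊆ G.edgeSet)
    (hMA : ∀ e ∈ M, ∀ x ∈ e, x ∈ A) (hM : ∀ x ∈ A, ∃! e, e ∈ M ∧ x ∈ e) :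
    Even A.ncard := by
  classical
  have := Fintype.ofFinite V
  let H : G.Subgraph :=
    { verts := A
      Adj := fun x y ↦ s(x, y) ∈ M
      adj_sub := fun h ↦ hMG h
      edge_vert := fun {x y} h ↦ hMA _ h x (Sym2.mem_mk_left x y)
      symm := ⟨fun x y h ↦ by rwa [Sym2.eq_swap]⟩ }
  have hH : H.IsMatching := by
    intro x hx
    obtain ⟨e, ⟨heM, hxe⟩, huniq⟩ := hM x hx
    obtain ⟨y, rfl⟩ := Sym2.mem_iff_exists.mp hxe
    refine ⟨y, heM, fun z hz ↦ ?_⟩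
    exact Sym2.congr_right.mp (huniq s(x, z) ⟨hz, Sym2.mem_mk_left x z⟩)
  have h := hH.even_card
  rwa [← Set.ncard_eq_toFinset_card'] at h

theorem IsPerfMatching.even_card {V : Type*} [Finite V] {G : SimpleGraph V} {M : Set (Sym2 V)}
    (hM : IsPerfMatching G M) : Even (Nat.card V) := by
  rw [← Set.ncard_univ]
  exact even_ncard_of_existsUnique_edge G Set.univ M hM.1 (fun _ _ _ _ ↦ trivial)
    fun x _ ↦ hM.2 x

theorem IsPerfMatching.eq_of_subset {V : Type*} {G : SimpleGraph V} {M N : Set (Sym2 V)}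
    (hM : IsPerfMatching G M) (hN : IsPerfMatching G N) (h : M ⊆ N) : N = M := by
  refine Set.Subset.antisymm (fun e he ↦ ?_) h
  obtain ⟨x, hx⟩ : ∃ x, x ∈ e := ⟨_, e.out_fst_mem⟩
  obtain ⟨f, ⟨hfM, hxf⟩, -⟩ := hM.2 x
  exact (hN.2 x).unique ⟨he, hx⟩ ⟨h hfM, hxf⟩ ▸ hfM

theorem isCompleteForcing_edgeSet {V : Type*} (G : SimpleGraph V) :
    IsCompleteForcing G G.edgeSet := by
  refine ⟨subset_rfl, fun M hM ↦ ⟨Set.inter_subset_left, fun N hN h ↦ ?_⟩⟩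
  rw [Set.inter_eq_left.mpr hM.1] at h
  exact hM.eq_of_subset hN h

namespace SimpleGraph.Walk

variable {V : Type*} {G : SimpleGraph V} {u : V} {c : G.Walk u u}

theorem IsCycle.ncard_support (hc : c.IsCycle) : {x | x ∈ c.support}.ncard = c.length := by
  have himg : {x | x ∈ c.support} = c.getVert '' Set.Iio c.length := by
    ext x
    simp only [Set.mem_ofPred_eq, mem_support_iff_exists_getVert, Set.mem_image, Set.mem_Iio]
    constructor
    · rintro ⟨i, rfl, hi⟩
      rcases hi.lt_or_eq with hi | rfl
      · exact ⟨i, hi, rfl⟩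
      · exact ⟨0, by have := hc.three_le_length; omega, by simp⟩
    · rintro ⟨i, hi, rfl⟩
      exact ⟨i, rfl, hi.le⟩
  rw [himg, Set.InjOn.ncard_image]
  · simp [Set.ncard_eq_toFinset_card']
  · intro i hi j hj hij
    simp only [Set.mem_Iio] at hi hj
    exact hc.getVert_injOn' (by simp only [Set.mem_ofPred_eq]; omega)
      (by simp only [Set.mem_ofPred_eq]; omega) hij

theorem IsCycle.getVert_eq_iff (hc : c.IsCycle) {i j : ℕ} (hi : i ≤ c.length)
    (hj : j ≤ c.length) : c.getVert i = c.getVert j ↔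
      i = j ∨ i = 0 ∧ j = c.length ∨ i = c.length ∧ j = 0 := by
  have hinj : ∀ {a b}, a < c.length → b < c.length → c.getVert a = c.getVert b → a = b :=
    fun ha hb h ↦ hc.getVert_injOn' (by simp only [Set.mem_ofPred_eq]; omega)
      (by simp only [Set.mem_ofPred_eq]; omega) h
  have h3 := hc.three_le_length
  have h0 : c.getVert c.length = c.getVert 0 := by simp
  constructor
  · intro h
    rcases hi.lt_or_eq with hi | rfl <;> rcases hj.lt_or_eq with hj | rfl
    · exact .inl (hinj hi hj h)
    · exact .inr (.inl ⟨hinj hi (by omega) (h.trans h0), rfl⟩)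
    · exact .inr (.inr ⟨rfl, (hinj (by omega) hj (h0.symm.trans h)).symm⟩)
    · exact .inl rfl
  · rintro (rfl | ⟨rfl, rfl⟩ | ⟨rfl, rfl⟩) <;> simp

/-- The edges of a walk whose position has the same parity as `a`. For an even cycle, these are
its two perfect matchings. -/
def frame {v : V} (c : G.Walk u v) (a : ℕ) : Set (Sym2 V) :=
  {e | ∃ i < c.length, i % 2 = a % 2 ∧ e = s(c.getVert i, c.getVert (i + 1))}

theorem frame_subset_edges {v : V} (c : G.Walk u v) (a : ℕ) : c.frame a ⊆ {e | e ∈ c.edges} := by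
  rintro _ ⟨i, hi, -, rfl⟩
  rw [Set.mem_ofPred_eq, ← mem_edges_toSubgraph, Subgraph.mem_edgeSet]
  exact c.toSubgraph_adj_getVert hi

theorem IsCycle.frame_disjoint (hc : c.IsCycle) {a b : ℕ} (hab : a % 2 ≠ b % 2) :
    Disjoint (c.frame a) (c.frame b) := by
  rw [Set.disjoint_left]
  rintro _ ⟨i, hi, hia, rfl⟩ ⟨j, hj, hjb, h⟩
  have h3 := hc.three_le_length
  rw [Sym2.eq_iff, hc.getVert_eq_iff (by omega) (by omega), hc.getVert_eq_iff (by omega) (by omega),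
    hc.getVert_eq_iff (by omega) (by omega), hc.getVert_eq_iff (by omega) (by omega)] at h
  omega

theorem IsCycle.existsUnique_mem_frame (hc : c.IsCycle) (heven : Even c.length) (a : ℕ) {x : V}
    (hx : x ∈ c.support) : ∃! e, e ∈ c.frame a ∧ x ∈ e := by
  have h3 := hc.three_le_length
  obtain ⟨k, hk⟩ := heven
  obtain ⟨j, rfl, hj⟩ := mem_support_iff_exists_getVert.mp hx
  have hexists : ∃ i < c.length, i % 2 = a % 2 ∧
      (c.getVert j = c.getVert i ∨ c.getVert j = c.getVert (i + 1)) := by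
    by_cases hja : j % 2 = a % 2
    · rcases hj.lt_or_eq with hj' | rfl
      · exact ⟨j, hj', hja, .inl rfl⟩
      · exact ⟨0, by omega, by omega, .inl (by simp)⟩
    · rcases j.eq_zero_or_pos with rfl | hj0
      · refine ⟨c.length - 1, by omega, by omega, .inr ?_⟩
        rw [Nat.sub_add_cancel (by omega)]
        simp
      · refine ⟨j - 1, by omega, by omega, .inr ?_⟩
        rw [Nat.sub_add_cancel (by omega)]
  obtain ⟨i, hi, hia, hji⟩ := hexists
  refine ⟨s(c.getVert i, c.getVert (i + 1)), ⟨⟨i, hi, hia, rfl⟩, Sym2.mem_iff.mpr hji⟩, ?_⟩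
  rintro _ ⟨⟨l, hl, hla, rfl⟩, hjl⟩
  rw [Sym2.mem_iff] at hjl
  rw [hc.getVert_eq_iff (by omega) (by omega), hc.getVert_eq_iff (by omega) (by omega)] at hji hjl
  obtain rfl : l = i := by omega
  rfl

end SimpleGraph.Walk

section NiceCycle

variable {V : Type*} {G : SimpleGraph V} {u : V} {c : G.Walk u u}

theorem IsNiceCycle.even_length [Finite V] (hpm : ∃ M, IsPerfMatching G M)
    (hc : IsNiceCycle G c) : Even c.length := by
  obtain ⟨N, hN⟩ := hpm
  obtain ⟨hcyc, M, hMG, hMout, hM⟩ := hc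
  have hcompl : Even {x | x ∈ c.support}ᶜ.ncard :=
    even_ncard_of_existsUnique_edge G _ M hMG hMout hM
  have hcard := Set.ncard_add_ncard_compl {x | x ∈ c.support}
  rw [hcyc.ncard_support] at hcard
  have hV := hN.even_card
  grind

theorem isPerfMatching_frame_union (hc : c.IsCycle) (heven : Even c.length) {M : Set (Sym2 V)}
    (hMG : M ⊆ G.edgeSet) (hMout : ∀ e ∈ M, ∀ x, x ∈ e → x ∉ c.support)
    (hM : ∀ x : V, x ∉ c.support → ∃! e, e ∈ M ∧ x ∈ e) (a : ℕ) :
    IsPerfMatching G (c.frame a ∪ M) := by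
  have hframe : ∀ e ∈ c.frame a, ∀ x ∈ e, x ∈ c.support := fun e he x hx ↦
    c.mem_support_of_mem_edges (c.frame_subset_edges a he) hx
  refine ⟨Set.union_subset (fun e he ↦ c.edges_subset_edgeSet (c.frame_subset_edges a he)) hMG,
    fun x ↦ ?_⟩
  by_cases hx : x ∈ c.support
  · obtain ⟨e, ⟨he, hxe⟩, huniq⟩ := hc.existsUnique_mem_frame heven a hx
    refine ⟨e, ⟨.inl he, hxe⟩, ?_⟩
    rintro f ⟨hf | hf, hxf⟩
    · exact huniq f ⟨hf, hxf⟩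
    · exact absurd hx (hMout f hf x hxf)
  · obtain ⟨e, ⟨he, hxe⟩, huniq⟩ := hM x hx
    refine ⟨e, ⟨.inr he, hxe⟩, ?_⟩
    rintro f ⟨hf | hf, hxf⟩
    · exact absurd (hframe f hf x hxf) hx
    · exact huniq f ⟨hf, hxf⟩

theorem IsCompleteForcing.inter_frame_nonempty {S : Set (Sym2 V)} (hS : IsCompleteForcing G S)
    (hc : IsNiceCycle G c) (heven : Even c.length) (a : ℕ) : (S ∩ c.frame a).Nonempty := by
  obtain ⟨hcyc, M, hMG, hMout, hM⟩ := hc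
  by_contra hempty
  have hpm := isPerfMatching_frame_union hcyc heven hMG hMout hM
  have heq : c.frame (a + 1) ∪ M = c.frame a ∪ M := by
    refine (hS.2 _ (hpm a)).2 _ (hpm (a + 1)) ?_
    rintro e ⟨he | he, heS⟩
    · exact absurd ⟨e, heS, he⟩ hempty
    · exact .inr he
  obtain ⟨e, ⟨he, hue⟩, -⟩ := hcyc.existsUnique_mem_frame heven a c.start_mem_support
  have hdisj : Disjoint (c.frame a) (c.frame (a + 1)) := hcyc.frame_disjoint (by omega)
  have he' : e ∈ c.frame (a + 1) ∪ M := heq ▸ Or.inl he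
  rcases he' with he' | he'
  · exact Set.disjoint_left.mp hdisj he he'
  · exact hMout e he' u hue c.start_mem_support

theorem IsCompleteForcing.two_le_ncard_inter_edges [Finite V] {S : Set (Sym2 V)}
    (hS : IsCompleteForcing G S) (hc : IsNiceCycle G c) (heven : Even c.length) :
    2 ≤ (S ∩ {e | e ∈ c.edges}).ncard := by
  obtain ⟨e, heS, he⟩ := hS.inter_frame_nonempty hc heven 0
  obtain ⟨f, hfS, hf⟩ := hS.inter_frame_nonempty hc heven 1
  rw [Nat.succ_le_iff, Set.one_lt_ncard]
  exact ⟨e, ⟨heS, c.frame_subset_edges 0 he⟩, f, ⟨hfS, c.frame_subset_edges 1 hf⟩,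
    (hc.1.frame_disjoint (by decide)).ne_of_mem he hf⟩

end NiceCycle

/-- If `G` is a finite graph with a perfect matching and `c 0, …, c (m-1)`
are nice cycles of `G` such that every edge of `G` belongs to at most two of their edge
sets, then `cfn G ≥ m`. -/
theorem cfn_lower_bound_of_nice_cycles {V : Type*} [Fintype V] (G : SimpleGraph V)
    (hpm : ∃ M, IsPerfMatching G M) (m : ℕ) (u : Fin m → V)
    (c : ∀ i : Fin m, G.Walk (u i) (u i))
    (hc : ∀ i, IsNiceCycle G (c i))
    (htwo : ∀ e : Sym2 V, Set.ncard {i : Fin m | e ∈ (c i).edges} ≤ 2) :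
    m ≤ cfn G := by
  classical
  refine le_csInf ⟨_, _, isCompleteForcing_edgeSet G, rfl⟩ ?_
  rintro _ ⟨S, hS, rfl⟩
  have hcount := Finset.card_mul_le_card_mul (s := (Finset.univ : Finset (Fin m)))
    (t := S.toFinset) (m := 2) (n := 2) (fun i e ↦ e ∈ (c i).edges)
    (fun i _ ↦ by
      have h := hS.two_le_ncard_inter_edges (hc i) ((hc i).even_length hpm)
      rw [Set.ncard_eq_toFinset_card'] at h
      refine h.trans (Finset.card_le_card fun e he ↦ ?_)
      simpa [Finset.mem_bipartiteAbove] using he)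
    (fun e _ ↦ by
      have h := htwo e
      rw [Set.ncard_eq_toFinset_card'] at h
      refine le_trans (Finset.card_le_card fun i hi ↦ ?_) h
      simpa [Finset.mem_bipartiteBelow] using hi)
  rw [Finset.card_univ, Fintype.card_fin, ← Set.ncard_eq_toFinset_card'] at hcount
  omega
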